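/- Let Ξ ⊆ Ω be a prediction set satisfying Assumption A. Then for every Borel measurable function ξ : C[0,T] → (−∞,∞] which is bounded from below, one has sup_{Q ∈ M(Ξ)} E_Q[ξ] = sup_τ sup_{Q ∈ M(Ξ)} E_Q[ξ(S^τ)], where the outer supremum on the right-hand side is taken over all 𝔽-stopping times τ and S^τ denotes the stopped canonical process, (S^τ)(ω) = ω^{τ(ω)}. -/

import Mathlib

open MeasureTheory Filter Set Topology
open scoped ENNReal Classical

noncomputable section

namespace PathwiseSuperhedging

/-- The path space `C[0,T]`: continuous functions on `[0,T]` with the sup-norm. -/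
abbrev Path (T : ℝ) := C(Set.Icc (0:ℝ) T, ℝ)

variable (T : ℝ)

instance : MeasurableSpace (Path T) := borel _
instance : BorelSpace (Path T) := ⟨rfl⟩

variable (hT : 0 ≤ T)

/-- time `0` as an element of `[0,T]`. -/
def t0 : Set.Icc (0:ℝ) T := ⟨0, le_refl 0, hT⟩

/-- clamp a real time into `[0,T]`. -/
def clamp (t : ℝ) : Set.Icc (0:ℝ) T := Set.projIcc 0 T hT t

/-- evaluation of a path at a (clamped) real time. -/
def ev (ω : Path T) (t : ℝ) : ℝ := ω (clamp T hT t)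

/-- The stopping times `σ^m_k`:  `σ^m_0 = 0` and
`σ^m_{k+1} = inf { t ≥ σ^m_k : |S_t - S_{σ^m_k}| ≥ 2^{-m} }` (equal to `T+1` if no such
time `t ≤ T` exists). -/
def sig (m : ℕ) : ℕ → Path T → ℝ
  | 0 => fun _ => 0
  | k + 1 => fun ω =>
      sInf ({t : ℝ | sig m k ω ≤ t ∧ t ≤ T ∧
        (2:ℝ) ^ (-(m:ℤ)) ≤ |ev T hT ω t - ev T hT ω (sig m k ω)|} ∪ {T + 1})

/-- The discretized integral `𝕊^m_t = ∑_k S_{σ^m_k} (S_{σ^m_{k+1} ∧ t} - S_{σ^m_k ∧ t})`. -/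
def Sm (m : ℕ) (t : ℝ) (ω : Path T) : ℝ :=
  ∑' k : ℕ, ev T hT ω (sig T hT m k ω) *
    (ev T hT ω (min (sig T hT m (k + 1) ω) t) - ev T hT ω (min (sig T hT m k ω) t))

/-- The pathwise integral `𝕊_t = liminf_m 𝕊^m_t`. -/
def SS (t : ℝ) (ω : Path T) : ℝ := Filter.liminf (fun m => Sm T hT m t ω) Filter.atTop

/-- The candidate quadratic variation `S_t² - S_0² - 2 𝕊_t`. -/
def qvRaw (ω : Path T) (t : ℝ) : ℝ := (ev T hT ω t) ^ 2 - (ev T hT ω 0) ^ 2 - 2 * SS T hT t ω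

/-- The set `Ω` of paths for which `𝕊^m → 𝕊` uniformly and
`t ↦ S_t² - S_0² - 2𝕊_t` is nondecreasing. -/
def BigOmega : Set (Path T) :=
  {ω | TendstoUniformly (fun m (t : Set.Icc (0:ℝ) T) => Sm T hT m (t : ℝ) ω)
        (fun t => SS T hT (t : ℝ) ω) Filter.atTop ∧
      MonotoneOn (qvRaw T hT ω) (Set.Icc (0:ℝ) T)}

/-- The pathwise quadratic variation `⟨ω⟩`, as an element of `C[0,T]`; it equals
`S² - S_0² - 2𝕊` for `ω ∈ Ω` (this function being continuous there) and `0` otherwise. -/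
def qv (ω : Path T) : Path T :=
  if h : ω ∈ BigOmega T hT ∧ Continuous fun t : Set.Icc (0:ℝ) T => qvRaw T hT ω (t : ℝ)
  then ⟨fun t => qvRaw T hT ω (t : ℝ), h.2⟩ else 0

/-- The raw filtration `F_t = σ(S_s : s ≤ t)` generated by the canonical process. -/
def Fraw (t : ℝ) : MeasurableSpace (Path T) :=
  ⨆ (s : Set.Icc (0:ℝ) T) (_ : (s : ℝ) ≤ t),
    MeasurableSpace.comap (fun ω : Path T => ω s) inferInstance

/-- The right-continuous filtration `F_{t+} = ⋂_{s > t} F_{s ∧ T}`. -/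
def Fplus (t : ℝ) : MeasurableSpace (Path T) :=
  ⨅ (s : ℝ) (_ : t < s), Fraw T (min s T)

/-- `τ` is a stopping time for the raw filtration `𝔽`. -/
def IsStopRaw (τ : Path T → ℝ) : Prop :=
  ∀ t ∈ Set.Icc (0:ℝ) T, MeasurableSet[Fraw T t] {ω | τ ω ≤ t}

/-- `τ` is a stopping time for the right-continuous filtration `𝔽₊`. -/
def IsStopPlus (τ : Path T → ℝ) : Prop :=
  ∀ t ∈ Set.Icc (0:ℝ) T, MeasurableSet[Fplus T t] {ω | τ ω ≤ t}

/-- `f` is measurable with respect to the σ-field `F_{τ+}`. -/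
def MeasAtStopPlus (τ f : Path T → ℝ) : Prop :=
  ∀ B : Set ℝ, MeasurableSet B → ∀ t ∈ Set.Icc (0:ℝ) T,
    MeasurableSet[Fplus T t] (f ⁻¹' B ∩ {ω | τ ω ≤ t})

/-- The set `ℋ` of simple trading strategies `H = ∑_{l=1}^L h_l 1_{(τ_l, τ_{l+1}]}`
with `𝔽₊`-stopping times `0 ≤ τ_1 ≤ ⋯ ≤ τ_{L+1} ≤ T` and bounded `F_{τ_l+}`-measurable
coefficients `h_l`. -/
structure SimpleStrategy where
  L : ℕ
  τ : Fin (L + 1) → Path T → ℝ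
  coeff : Fin L → Path T → ℝ
  τ_nonneg : ∀ ω, 0 ≤ τ 0 ω
  τ_mono : ∀ (l : Fin L) (ω), τ l.castSucc ω ≤ τ l.succ ω
  τ_le : ∀ ω, τ (Fin.last L) ω ≤ T
  τ_stop : ∀ l, IsStopPlus T (τ l)
  coeff_bdd : ∀ l, ∃ C : ℝ, ∀ ω, |coeff l ω| ≤ C
  coeff_meas : ∀ l : Fin L, MeasAtStopPlus T (τ l.castSucc) (coeff l)

/-- The pathwise stochastic integral `(H · X)_t(ω)` of a simple strategy against a process. -/
def integ (H : SimpleStrategy T) (X : ℝ → Path T → ℝ) (t : ℝ) (ω : Path T) : ℝ :=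
  ∑ l : Fin H.L, H.coeff l ω *
    (X (min (H.τ l.succ ω) t) ω - X (min (H.τ l.castSucc ω) t) ω)

/-- The canonical process `S_t(ω) = ω(t)`. -/
def Sproc (t : ℝ) (ω : Path T) : ℝ := ev T hT ω t

/-- `X` is a `Q`-`𝔽`-martingale (on the time interval `[0,T]`). -/
def IsMart (Q : Measure (Path T)) (X : ℝ → Path T → ℝ) : Prop :=
  (∀ t ∈ Set.Icc (0:ℝ) T, Integrable (X t) Q) ∧
  ∀ s t : ℝ, s ∈ Set.Icc (0:ℝ) T → t ∈ Set.Icc (0:ℝ) T → s ≤ t →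
    ∀ A : Set (Path T), MeasurableSet[Fraw T s] A →
      ∫ ω in A, X t ω ∂Q = ∫ ω in A, X s ω ∂Q

/-- `X` is a `Q`-`𝔽`-local martingale: there are `𝔽`-stopping times increasing `Q`-a.s.
to `∞` such that each stopped process is a `Q`-`𝔽`-martingale. -/
def IsLocalMart (Q : Measure (Path T)) (X : ℝ → Path T → ℝ) : Prop :=
  ∃ τ : ℕ → Path T → ℝ,
    (∀ m, IsStopRaw T (τ m)) ∧
    (∀ᵐ ω ∂Q, Monotone (fun m => τ m ω) ∧ Tendsto (fun m => τ m ω) atTop atTop) ∧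
    (∀ m, IsMart T Q (fun t ω => X (min (τ m ω) t) ω))

/-- The set `M(Ξ)` of local martingale measures concentrated on `Ξ`. -/
def MSet (Ξ : Set (Path T)) : Set (Measure (Path T)) :=
  {Q | IsProbabilityMeasure Q ∧ IsLocalMart T Q (Sproc T hT) ∧ Q Ξ = 1}

/-- The set `M_Z(Ξ)` of local martingale measures concentrated on `Ξ` with `E_Q[Z] < ∞`. -/
def MZSet (Ξ : Set (Path T)) (Z : Path T → ℝ≥0∞) : Set (Measure (Path T)) :=
  {Q | IsProbabilityMeasure Q ∧ IsLocalMart T Q (Sproc T hT) ∧ Q Ξ = 1 ∧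
       ∫⁻ ω, Z ω ∂Q ≠ ⊤}

/-- The stopped path `ω^t(s) = ω(t ∧ s)`. -/
def stopPath (ω : Path T) (t : Set.Icc (0:ℝ) T) : Path T :=
  ⟨fun s => ω ⟨min t.1 s.1, le_min t.2.1 s.2.1, (min_le_left _ _).trans t.2.2⟩,
    ω.continuous.comp ((continuous_const.min continuous_subtype_val).subtype_mk _)⟩

/-- Assumption A on the prediction set `Ξ` and its lift `Ξ̄`. -/
structure AssumptionA (Ξ : Set (Path T)) (Xibar : Set (Path T × Path T)) : Prop where
  xi_nonempty : Ξ.Nonempty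
  xibar_nonempty : Xibar.Nonempty
  xi_eq : Ξ = {ω ∈ BigOmega T hT | (ω, qv T hT ω) ∈ Xibar}
  A1 : ∃ K : ℕ → Set (Path T × Path T), (∀ n, IsCompact (K n)) ∧ Xibar = ⋃ n, K n
  A2 : ∀ p ∈ Xibar, p.2 (t0 T hT) = 0 ∧ Monotone p.2
  A3 : ∀ p ∈ Xibar, ∀ t : Set.Icc (0:ℝ) T, (stopPath T p.1 t, stopPath T p.2 t) ∈ Xibar

/-! ### The enlarged space -/

/-- The enlarged space `Ω̄ = C[0,T] × C[0,T]`. -/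
abbrev PathPair (T : ℝ) := Path T × Path T

/-- The embedding `ψ(ω) = (ω, ⟨ω⟩)`. -/
def psiMap (ω : Path T) : PathPair T := (ω, qv T hT ω)

/-- The diagonal set `Δ̄ = ψ(Ω)`. -/
def Delta : Set (PathPair T) := psiMap T hT '' BigOmega T hT

/-- The first canonical process `S̄_t(ω,ν) = ω(t)` on the enlarged space. -/
def SbarProc (t : ℝ) (p : PathPair T) : ℝ := ev T hT p.1 t

/-- The second canonical process `V̄_t(ω,ν) = ν(t)` on the enlarged space. -/
def VbarProc (t : ℝ) (p : PathPair T) : ℝ := ev T hT p.2 t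

/-- The process `𝕊̄ = (S̄² - S̄_0² - V̄)/2` on the enlarged space. -/
def SSbarProc (t : ℝ) (p : PathPair T) : ℝ :=
  ((ev T hT p.1 t) ^ 2 - (ev T hT p.1 0) ^ 2 - ev T hT p.2 t) / 2

/-- The raw filtration `F̄_t = σ(S̄_s, V̄_s : s ≤ t)` on the enlarged space. -/
def FbarRaw (t : ℝ) : MeasurableSpace (PathPair T) :=
  ⨆ (s : Set.Icc (0:ℝ) T) (_ : (s : ℝ) ≤ t),
    MeasurableSpace.comap (fun p : PathPair T => (p.1 s, p.2 s)) inferInstance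

/-- The right-continuous filtration `F̄_{t+} = ⋂_{s>t} F̄_{s ∧ T}` on the enlarged space. -/
def FbarPlus (t : ℝ) : MeasurableSpace (PathPair T) :=
  ⨅ (s : ℝ) (_ : t < s), FbarRaw T (min s T)

/-- The σ-field generated by all subsets of `Δ̄ᶜ`. -/
def nullDelta : MeasurableSpace (PathPair T) :=
  MeasurableSpace.generateFrom {N : Set (PathPair T) | N ⊆ (Delta T hT)ᶜ}

/-- The `Δ̄`-augmented raw filtration `F̄^Δ_t`. -/
def FbarDelta (t : ℝ) : MeasurableSpace (PathPair T) := FbarRaw T t ⊔ nullDelta T hT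

/-- The `Δ̄`-augmented right-continuous filtration `F̄^Δ_{t+}`. -/
def FbarDeltaPlus (t : ℝ) : MeasurableSpace (PathPair T) := FbarPlus T t ⊔ nullDelta T hT

/-- `τ` is a stopping time for the raw filtration `𝔽̄` on the enlarged space. -/
def IsStopBarRaw (τ : PathPair T → ℝ) : Prop :=
  ∀ t ∈ Set.Icc (0:ℝ) T, MeasurableSet[FbarRaw T t] {p | τ p ≤ t}

/-- `τ` is a stopping time for the filtration `𝔽̄₊^Δ`. -/
def IsStopBarDeltaPlus (τ : PathPair T → ℝ) : Prop :=
  ∀ t ∈ Set.Icc (0:ℝ) T, MeasurableSet[FbarDeltaPlus T hT t] {p | τ p ≤ t}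

/-- `f` is measurable with respect to `F̄^Δ_{τ+}`. -/
def MeasAtStopBarDeltaPlus (τ f : PathPair T → ℝ) : Prop :=
  ∀ B : Set ℝ, MeasurableSet B → ∀ t ∈ Set.Icc (0:ℝ) T,
    MeasurableSet[FbarDeltaPlus T hT t] (f ⁻¹' B ∩ {p | τ p ≤ t})

/-- The set `ℋ̄` of simple strategies on the enlarged space. -/
structure SimpleStrategyBar where
  L : ℕ
  τ : Fin (L + 1) → PathPair T → ℝ
  coeff : Fin L → PathPair T → ℝ
  τ_nonneg : ∀ p, 0 ≤ τ 0 p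
  τ_mono : ∀ (l : Fin L) (p), τ l.castSucc p ≤ τ l.succ p
  τ_le : ∀ p, τ (Fin.last L) p ≤ T
  τ_stop : ∀ l, IsStopBarDeltaPlus T hT (τ l)
  coeff_bdd : ∀ l, ∃ C : ℝ, ∀ p, |coeff l p| ≤ C
  coeff_meas : ∀ l : Fin L, MeasAtStopBarDeltaPlus T hT (τ l.castSucc) (coeff l)

/-- The pathwise stochastic integral on the enlarged space. -/
def integBar (H : SimpleStrategyBar T hT) (X : ℝ → PathPair T → ℝ) (t : ℝ)
    (p : PathPair T) : ℝ :=
  ∑ l : Fin H.L, H.coeff l p *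
    (X (min (H.τ l.succ p) t) p - X (min (H.τ l.castSucc p) t) p)

/-- `X` is a `Q̄`-`𝔽̄`-martingale on the enlarged space. -/
def IsMartBar (Q : Measure (PathPair T)) (X : ℝ → PathPair T → ℝ) : Prop :=
  (∀ t ∈ Set.Icc (0:ℝ) T, Integrable (X t) Q) ∧
  ∀ s t : ℝ, s ∈ Set.Icc (0:ℝ) T → t ∈ Set.Icc (0:ℝ) T → s ≤ t →
    ∀ A : Set (PathPair T), MeasurableSet[FbarRaw T s] A →
      ∫ p in A, X t p ∂Q = ∫ p in A, X s p ∂Q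

/-- `X` is a `Q̄`-`𝔽̄`-local martingale on the enlarged space. -/
def IsLocalMartBar (Q : Measure (PathPair T)) (X : ℝ → PathPair T → ℝ) : Prop :=
  ∃ τ : ℕ → PathPair T → ℝ,
    (∀ m, IsStopBarRaw T (τ m)) ∧
    (∀ᵐ p ∂Q, Monotone (fun m => τ m p) ∧ Tendsto (fun m => τ m p) atTop atTop) ∧
    (∀ m, IsMartBar T Q (fun t p => X (min (τ m p) t) p))

/-- The set `M̄(Ξ̄)` of measures on the enlarged space under which `S̄` and `𝕊̄` are local
martingales and which are concentrated on `Ξ̄`. -/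
def MbarSet (Xibar : Set (PathPair T)) : Set (Measure (PathPair T)) :=
  {Q | IsProbabilityMeasure Q ∧ IsLocalMartBar T Q (SbarProc T hT) ∧
       IsLocalMartBar T Q (SSbarProc T hT) ∧ Q Xibar = 1}

/-- The set `M̄_{Z̄}(Ξ̄)`. -/
def MbarZSet (Xibar : Set (PathPair T)) (Zbar : PathPair T → ℝ≥0∞) :
    Set (Measure (PathPair T)) :=
  {Q | IsProbabilityMeasure Q ∧ IsLocalMartBar T Q (SbarProc T hT) ∧
       IsLocalMartBar T Q (SSbarProc T hT) ∧ Q Xibar = 1 ∧ ∫⁻ p, Zbar p ∂Q ≠ ⊤}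

/-! ### Expectations and superhedging functionals -/

/-- The positive part of an extended real number, as an element of `[0,∞]`. -/
def erealPos (x : EReal) : ℝ≥0∞ := if x = ⊤ then ⊤ else ENNReal.ofReal x.toReal

/-- The expectation `E_Q[ξ]` of an extended-real-valued random variable, as an
extended real number (positive part minus negative part). -/
def expEReal {α : Type*} [MeasurableSpace α] (Q : Measure α) (ξ : α → EReal) : EReal :=
  ((∫⁻ x, erealPos (ξ x) ∂Q : ℝ≥0∞) : EReal) - ((∫⁻ x, erealPos (-ξ x) ∂Q : ℝ≥0∞) : EReal)

/-- The set of initial capitals `λ` that allow superhedging `ξ` on `Ξ`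
(trading in `S` and `𝕊` with simple strategies, in the liminf sense). -/
def PhiSet (Ξ : Set (Path T)) (ξ : Path T → EReal) : Set ℝ :=
  {lam : ℝ | ∃ H G : ℕ → SimpleStrategy T,
    (∀ n : ℕ, ∀ t ∈ Set.Icc (0:ℝ) T, ∀ ω ∈ Ξ,
      0 ≤ lam + integ T (H n) (Sproc T hT) t ω + integ T (G n) (SS T hT) t ω) ∧
    (∀ ω ∈ Ξ, ξ ω ≤ (lam : EReal) +
      Filter.liminf (fun n =>
        ((integ T (H n) (Sproc T hT) T ω + integ T (G n) (SS T hT) T ω : ℝ) : EReal))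
        Filter.atTop)}

/-- The superhedging price `Φ(ξ)`. -/
def Phi (Ξ : Set (Path T)) (ξ : Path T → EReal) : EReal :=
  sInf ((fun lam : ℝ => (lam : EReal)) '' PhiSet T hT Ξ ξ)

/-- The supremum of the pricing functionals `E_Q[ξ]` over `Q ∈ M(Ξ)`,
for a nonnegative claim `ξ`. -/
def supMart (Ξ : Set (Path T)) (ξ : Path T → ℝ≥0∞) : ℝ≥0∞ :=
  ⨆ Q ∈ MSet T hT Ξ, ∫⁻ ω, ξ ω ∂Q

/-- The liminf-closure `𝒢^Ξ_λ`: the smallest set of functions `C[0,T] → [-∞,∞]`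
containing `λ + (H·S)_T` for admissible simple `H` and closed under countable liminf. -/
inductive GG (Ξ : Set (Path T)) (lam : ℝ) : (Path T → EReal) → Prop
  | base (H : SimpleStrategy T)
      (hadm : ∀ t ∈ Set.Icc (0:ℝ) T, ∀ ω ∈ Ξ, 0 ≤ lam + integ T H (Sproc T hT) t ω) :
      GG Ξ lam (fun ω => ((lam + integ T H (Sproc T hT) T ω : ℝ) : EReal))
  | lim (X : ℕ → Path T → EReal) (h : ∀ n, GG Ξ lam (X n)) :
      GG Ξ lam (fun ω => Filter.liminf (fun n => X n ω) Filter.atTop)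

/-- The superhedging price `Φ^cl(ξ)` defined via the liminf-closure. -/
def PhiCl (Ξ : Set (Path T)) (ξ : Path T → EReal) : EReal :=
  sInf {x : EReal | ∃ lam : ℝ, x = (lam : EReal) ∧
    ∃ Y : Path T → EReal, GG T hT Ξ lam Y ∧ ∀ ω ∈ Ξ, ξ ω ≤ Y ω}


/-- The set of initial capitals allowing superhedging on the enlarged space
(superhedging on `Δ̄ ∩ Ξ̄`). -/
def PhiBarSet (Xibar : Set (PathPair T)) (ξ : PathPair T → EReal) : Set ℝ :=
  {lam : ℝ | ∃ H G : ℕ → SimpleStrategyBar T hT,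
    (∀ n : ℕ, ∀ t ∈ Set.Icc (0:ℝ) T, ∀ p ∈ Delta T hT ∩ Xibar,
      0 ≤ lam + integBar T hT (H n) (SbarProc T hT) t p
            + integBar T hT (G n) (SSbarProc T hT) t p) ∧
    (∀ p ∈ Delta T hT ∩ Xibar, ξ p ≤ (lam : EReal) +
      Filter.liminf (fun n =>
        ((integBar T hT (H n) (SbarProc T hT) T p
          + integBar T hT (G n) (SSbarProc T hT) T p : ℝ) : EReal)) Filter.atTop)}

/-- The superhedging price `Φ̄(ξ̄)` on the enlarged space. -/
def PhiBar (Xibar : Set (PathPair T)) (ξ : PathPair T → EReal) : EReal :=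
  sInf ((fun lam : ℝ => (lam : EReal)) '' PhiBarSet T hT Xibar ξ)

/-- The supremum of pricing functionals over `M̄(Ξ̄)` for a nonnegative claim. -/
def supMartBar (Xibar : Set (PathPair T)) (ξ : PathPair T → ℝ≥0∞) : ℝ≥0∞ :=
  ⨆ Q ∈ MbarSet T hT Xibar, ∫⁻ p, ξ p ∂Q

/-- Assumption B on the prediction set `Ξ`, determined by a growth function `Z̄`
(with values in `[1,∞]`). -/
structure AssumptionB (Ξ : Set (Path T)) (Zbar : PathPair T → ℝ≥0∞) : Prop where
  xi_nonempty : Ξ.Nonempty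
  one_le : ∀ p, 1 ≤ Zbar p
  xi_eq : Ξ = {ω ∈ BigOmega T hT | Zbar (ω, qv T hT ω) ≠ ⊤}
  B1 : ∀ c : ℝ≥0∞, c ≠ ⊤ → IsCompact {p : PathPair T | Zbar p ≤ c}
  B2 : ∀ p : PathPair T, Zbar p ≠ ⊤ → p.2 (t0 T hT) = 0 ∧ Monotone p.2
  B3 : ∀ p : PathPair T, ENNReal.ofReal (‖p.1‖ + ‖p.2‖) ≤ Zbar p

/-- The set of initial capitals allowing `Z`-admissible superhedging of `ξ` on `Ξ`. -/
def PhiZSet (Ξ : Set (Path T)) (Z : Path T → ℝ≥0∞) (ξ : Path T → EReal) : Set ℝ :=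
  {lam : ℝ | ∃ c : ℝ, 0 ≤ c ∧ ∃ H G : ℕ → SimpleStrategy T,
    (∀ n : ℕ, ∀ ω ∈ Ξ,
      -(c * (Z ω).toReal) ≤
        lam + integ T (H n) (Sproc T hT) T ω + integ T (G n) (SS T hT) T ω) ∧
    (∀ ω ∈ Ξ, ξ ω ≤ (lam : EReal) +
      Filter.liminf (fun n =>
        ((integ T (H n) (Sproc T hT) T ω + integ T (G n) (SS T hT) T ω : ℝ) : EReal))
        Filter.atTop)}

/-- The superhedging price `Φ^Z(ξ)`. -/
def PhiZ (Ξ : Set (Path T)) (Z : Path T → ℝ≥0∞) (ξ : Path T → EReal) : EReal :=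
  sInf ((fun lam : ℝ => (lam : EReal)) '' PhiZSet T hT Ξ Z ξ)

/-- The `α`-Hölder norm `‖ω‖_α = |ω(0)| + sup_{s ≠ t} |ω(t) - ω(s)| / |t-s|^α`,
with values in `[0,∞]`. -/
def holderNormE (α : ℝ) (ω : Path T) : ℝ≥0∞ :=
  ENNReal.ofReal |ω (t0 T hT)| +
    ⨆ (s : Set.Icc (0:ℝ) T) (t : Set.Icc (0:ℝ) T) (_ : s ≠ t),
      ENNReal.ofReal (|ω t - ω s| / |t.1 - s.1| ^ α)

/-- The set of Hölder continuous paths `⋃_n { ω : ‖ω‖_{1/n} ≤ n }`. -/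
def CHolder : Set (Path T) :=
  ⋃ n : ℕ, {ω : Path T | 0 < n ∧ holderNormE T hT (1 / n) ω ≤ (n : ℝ≥0∞)}

end PathwiseSuperhedging

namespace PathwiseSuperhedging

section PartOne
variable {T : ℝ} (hT : 0 ≤ T)

lemma ev_cont (ω : Path T) : Continuous (ev T hT ω) :=
  ω.continuous.comp (continuous_projIcc (h := hT))

lemma ev_le_zero (ω : Path T) {t : ℝ} (h : t ≤ 0) : ev T hT ω t = ev T hT ω 0 := by
  unfold ev clamp
  rw [projIcc_of_le_left hT h, projIcc_of_le_left hT le_rfl]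

lemma ev_of_mem (ω : Path T) (t : Set.Icc (0:ℝ) T) : ev T hT ω t = ω t := by
  unfold ev clamp
  rw [projIcc_val]

lemma ev_clamp (ω : Path T) (t : ℝ) : ev T hT ω (clamp T hT t) = ev T hT ω t := by
  rw [ev_of_mem]; rfl

lemma ev_stopPath (ω : Path T) (r : Set.Icc (0:ℝ) T) (u : ℝ) :
    ev T hT (stopPath T ω r) u = ev T hT ω (min r u) := by
  unfold ev stopPath clamp
  simp only [ContinuousMap.coe_mk]
  congr 1
  apply Subtype.ext
  simp only [coe_projIcc]
  have h1 := r.2.1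
  have h2 := r.2.2
  rw [min_comm T u, min_comm T (min _ u), min_assoc, max_min_distrib_left,
    max_min_distrib_left, max_min_distrib_left]
  rw [max_eq_right h1]

lemma sig_le (m k : ℕ) (ω : Path T) : sig T hT m k ω ≤ T + 1 := by
  cases k with
  | zero => simp only [sig]; linarith
  | succ k =>
    simp only [sig]
    refine csInf_le ?_ (Or.inr rfl)
    refine ⟨min (sig T hT m k ω) (T+1), ?_⟩
    rintro x (hx | hx)
    · exact (min_le_left _ _).trans hx.1
    · rw [mem_singleton_iff.1 hx]; exact min_le_right _ _

lemma sig_bdd (m k : ℕ) (ω : Path T) : BddBelow ({t : ℝ | sig T hT m k ω ≤ t ∧ t ≤ T ∧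
        (2:ℝ) ^ (-(m:ℤ)) ≤ |ev T hT ω t - ev T hT ω (sig T hT m k ω)|} ∪ {T + 1}) := by
  refine ⟨sig T hT m k ω, ?_⟩
  rintro x (hx | hx)
  · exact hx.1
  · rw [mem_singleton_iff.1 hx]; exact sig_le hT m k ω

lemma sig_mem (m k : ℕ) (ω : Path T) : sig T hT m (k+1) ω ∈ ({t : ℝ | sig T hT m k ω ≤ t ∧ t ≤ T ∧
        (2:ℝ) ^ (-(m:ℤ)) ≤ |ev T hT ω t - ev T hT ω (sig T hT m k ω)|} ∪ {T + 1}) := by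
  have hc : IsClosed ({t : ℝ | sig T hT m k ω ≤ t ∧ t ≤ T ∧
        (2:ℝ) ^ (-(m:ℤ)) ≤ |ev T hT ω t - ev T hT ω (sig T hT m k ω)|} ∪ {T + 1}) := by
    refine IsClosed.union ?_ isClosed_singleton
    have h3 : IsClosed {t : ℝ | (2:ℝ) ^ (-(m:ℤ)) ≤
        |ev T hT ω t - ev T hT ω (sig T hT m k ω)|} :=
      isClosed_le continuous_const ((ev_cont hT ω).sub continuous_const).abs
    exact (isClosed_le continuous_const continuous_id).inter
      ((isClosed_le continuous_id continuous_const).inter h3)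
  exact hc.csInf_mem ⟨T+1, Or.inr rfl⟩ (sig_bdd hT m k ω)

lemma sig_le_succ (m k : ℕ) (ω : Path T) : sig T hT m k ω ≤ sig T hT m (k+1) ω := by
  rcases sig_mem hT m k ω with h | h
  · exact h.1
  · rw [mem_singleton_iff.1 h]; exact sig_le hT m k ω

lemma sig_mono (m : ℕ) (ω : Path T) : Monotone (fun k => sig T hT m k ω) :=
  monotone_nat_of_le_succ fun k => sig_le_succ hT m k ω

lemma sig_succ_le (m k : ℕ) (ω : Path T) {t : ℝ} (h1 : sig T hT m k ω ≤ t) (h2 : t ≤ T)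
    (h3 : (2:ℝ) ^ (-(m:ℤ)) ≤ |ev T hT ω t - ev T hT ω (sig T hT m k ω)|) :
    sig T hT m (k+1) ω ≤ t :=
  csInf_le (sig_bdd hT m k ω) (Or.inl ⟨h1, h2, h3⟩)

lemma sig_eventually (m : ℕ) (ω : Path T) : ∃ N, ∀ k ≥ N, sig T hT m k ω = T + 1 := by
  by_contra hcon
  have hne : ∀ k, sig T hT m k ω ≠ T + 1 := by
    intro k hk
    refine hcon ⟨k, fun j hj => le_antisymm (sig_le hT m j ω) ?_⟩
    rw [← hk]; exact sig_mono hT m ω hj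
  have hj : ∀ k, (2:ℝ) ^ (-(m:ℤ)) ≤
      |ev T hT ω (sig T hT m (k+1) ω) - ev T hT ω (sig T hT m k ω)| := by
    intro k
    rcases sig_mem hT m k ω with h | h
    · exact h.2.2
    · exact absurd (mem_singleton_iff.1 h) (hne (k+1))
  have hlim := tendsto_atTop_ciSup (sig_mono hT m ω)
    ⟨T+1, by rintro _ ⟨k, rfl⟩; exact sig_le hT m k ω⟩
  have h1 := ((ev_cont hT ω).tendsto _).comp hlim
  have h2 := h1.comp (tendsto_add_atTop_nat 1)
  have h3 := (h2.sub h1).abs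
  rw [sub_self, abs_zero] at h3
  have h4 := ge_of_tendsto' h3 hj
  have : (0:ℝ) < (2:ℝ) ^ (-(m:ℤ)) := by positivity
  linarith

lemma Sm_cont (m : ℕ) (ω : Path T) :
    Continuous fun t : Set.Icc (0:ℝ) T => Sm T hT m (t:ℝ) ω := by
  obtain ⟨N, hN⟩ := sig_eventually hT m ω
  have : (fun t : Set.Icc (0:ℝ) T => Sm T hT m (t:ℝ) ω) = fun t : Set.Icc (0:ℝ) T =>
      ∑ k ∈ Finset.range N, ev T hT ω (sig T hT m k ω) *
    (ev T hT ω (min (sig T hT m (k + 1) ω) t) - ev T hT ω (min (sig T hT m k ω) t)) := by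
    funext t
    unfold Sm
    refine tsum_eq_sum fun k hk => ?_
    have hk' : N ≤ k := by simpa using hk
    rw [hN k hk', hN (k+1) (by omega)]
    simp
  rw [this]
  refine continuous_finsetSum _ fun k _ => ?_
  have := ev_cont hT ω
  fun_prop

lemma sig_stop (m k : ℕ) (ω : Path T) (r : Set.Icc (0:ℝ) T) :
    (sig T hT m k ω ≤ r ∧ sig T hT m k (stopPath T ω r) = sig T hT m k ω) ∨
    ((r:ℝ) < sig T hT m k ω ∧ (r:ℝ) < sig T hT m k (stopPath T ω r)) := by
  induction k with
  | zero => left; exact ⟨r.2.1, rfl⟩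
  | succ k ih =>
    rcases ih with ⟨h1, h2⟩ | ⟨h1, h2⟩
    · have key : ∀ t : ℝ, t ≤ r → (sig T hT m (k+1) ω ≤ t ↔
          sig T hT m (k+1) (stopPath T ω r) ≤ t) := by
        intro t ht
        have hrT := r.2.2
        constructor
        · intro h
          rcases sig_mem hT m k ω with hm | hm
          · refine (sig_succ_le hT m k _ (t := sig T hT m (k+1) ω) ?_ ?_ ?_).trans h
            · rw [h2]; exact hm.1
            · exact hm.2.1
            · rw [h2, ev_stopPath, ev_stopPath, min_eq_right h1, min_eq_right (h.trans ht)]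
              exact hm.2.2
          · rw [mem_singleton_iff.1 hm] at h; linarith
        · intro h
          rcases sig_mem hT m k (stopPath T ω r) with hm | hm
          · refine (sig_succ_le hT m k _ (t := sig T hT m (k+1) (stopPath T ω r)) ?_ ?_ ?_).trans h
            · rw [← h2]; exact hm.1
            · exact hm.2.1
            · have := hm.2.2
              rwa [h2, ev_stopPath, ev_stopPath, min_eq_right h1, min_eq_right (h.trans ht)] at this
          · rw [mem_singleton_iff.1 hm] at h; linarith
      by_cases hc : sig T hT m (k+1) ω ≤ r
      · left
        refine ⟨hc, le_antisymm ((key _ hc).1 le_rfl) ?_⟩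
        exact (key _ ((key _ le_rfl).1 hc)).2 le_rfl
      · right
        refine ⟨not_le.1 hc, not_le.1 fun h => hc ((key _ le_rfl).2 h)⟩
    · right
      exact ⟨h1.trans_le (sig_le_succ hT m k _), h2.trans_le (sig_le_succ hT m k _)⟩

lemma min_sig_stop (m k : ℕ) (ω : Path T) (r : Set.Icc (0:ℝ) T) :
    min (r:ℝ) (sig T hT m k (stopPath T ω r)) = min (r:ℝ) (sig T hT m k ω) := by
  rcases sig_stop hT m k ω r with ⟨_, h⟩ | ⟨h1, h2⟩
  · rw [h]
  · rw [min_eq_left h1.le, min_eq_left h2.le]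

lemma Sm_stop (m : ℕ) (ω : Path T) (r : Set.Icc (0:ℝ) T) (t : ℝ) :
    Sm T hT m t (stopPath T ω r) = Sm T hT m (min r t) ω := by
  unfold Sm
  refine tsum_congr fun k => ?_
  have e : ∀ j, ev T hT (stopPath T ω r) (min (sig T hT m j (stopPath T ω r)) t) =
      ev T hT ω (min (sig T hT m j ω) (min r t)) := by
    intro j
    rw [ev_stopPath, ← min_assoc, min_sig_stop, min_comm (r:ℝ), min_assoc]
  rw [e, e]
  rcases sig_stop hT m k ω r with ⟨h1, h2⟩ | ⟨h1, h2⟩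
  · rw [h2, ev_stopPath, min_eq_right h1]
  · have h3 := h1.trans_le (sig_le_succ hT m k ω)
    rw [min_eq_right ((min_le_left _ _).trans h1.le), min_eq_right ((min_le_left _ _).trans h3.le)]
    simp

lemma SS_stop (ω : Path T) (r : Set.Icc (0:ℝ) T) (t : ℝ) :
    SS T hT t (stopPath T ω r) = SS T hT (min r t) ω := by
  unfold SS
  simp_rw [Sm_stop]

lemma qvRaw_stop (ω : Path T) (r : Set.Icc (0:ℝ) T) (t : ℝ) :
    qvRaw T hT (stopPath T ω r) t = qvRaw T hT ω (min r t) := by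
  unfold qvRaw
  rw [SS_stop, ev_stopPath, ev_stopPath, min_eq_right r.2.1]

lemma qvRaw_cont {ω : Path T} (h : ω ∈ BigOmega T hT) :
    Continuous fun t : Set.Icc (0:ℝ) T => qvRaw T hT ω (t : ℝ) := by
  have h1 : Continuous fun t : Set.Icc (0:ℝ) T => SS T hT (t : ℝ) ω :=
    h.1.continuous (Frequently.of_forall fun m => Sm_cont hT m ω)
  have := ev_cont hT ω
  unfold qvRaw
  fun_prop

lemma stop_mem_BigOmega {ω : Path T} (h : ω ∈ BigOmega T hT) (r : Set.Icc (0:ℝ) T) :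
    stopPath T ω r ∈ BigOmega T hT := by
  refine ⟨?_, ?_⟩
  · have := h.1.comp (fun t : Set.Icc (0:ℝ) T =>
      (⟨min r.1 t.1, le_min r.2.1 t.2.1, (min_le_left _ _).trans r.2.2⟩ : Set.Icc (0:ℝ) T))
    simp_rw [Sm_stop, SS_stop]
    exact this
  · intro s hs t ht hst
    rw [qvRaw_stop, qvRaw_stop]
    exact h.2 ⟨le_min r.2.1 hs.1, (min_le_left _ _).trans r.2.2⟩
      ⟨le_min r.2.1 ht.1, (min_le_left _ _).trans r.2.2⟩ (min_le_min le_rfl hst)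

lemma qv_stop {ω : Path T} (h : ω ∈ BigOmega T hT) (r : Set.Icc (0:ℝ) T) :
    qv T hT (stopPath T ω r) = stopPath T (qv T hT ω) r := by
  have h' := stop_mem_BigOmega hT h r
  unfold qv
  rw [dif_pos ⟨h', qvRaw_cont hT h'⟩, dif_pos ⟨h, qvRaw_cont hT h⟩]
  ext t
  simp only [ContinuousMap.coe_mk, stopPath]
  exact qvRaw_stop hT ω r t

lemma stop_mem_Xi {Ξ : Set (Path T)} {Xibar : Set (PathPair T)} (hA : AssumptionA T hT Ξ Xibar)
    {ω : Path T} (h : ω ∈ Ξ) (r : Set.Icc (0:ℝ) T) : stopPath T ω r ∈ Ξ := by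
  have h0 := h
  rw [hA.xi_eq] at h0 ⊢
  refine ⟨stop_mem_BigOmega hT h0.1 r, ?_⟩
  rw [qv_stop hT h0.1]
  exact hA.A3 _ h0.2 r

end PartOne

end PathwiseSuperhedging

namespace PathwiseSuperhedging

section PartTwo
variable {T : ℝ} (hT : 0 ≤ T)

lemma meas_path {α : Type*} {m : MeasurableSpace α} {f : α → Path T}
    (h : ∀ s, Measurable fun a => f a s) : Measurable f := by
  have hball : ∀ (g : Path T) (r : ℝ), 0 ≤ r → MeasurableSet (f ⁻¹' Metric.closedBall g r) := by
    intro g r hr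
    rcases isEmpty_or_nonempty (Set.Icc (0:ℝ) T) with he | hne
    · have : f ⁻¹' Metric.closedBall g r = univ := by
        ext a
        simp only [mem_preimage, Metric.mem_closedBall, mem_univ, iff_true]
        rw [ContinuousMap.dist_le hr]
        exact fun x => (he.false x).elim
      rw [this]; exact MeasurableSet.univ
    have : f ⁻¹' Metric.closedBall g r = ⋂ n : ℕ,
        {a | dist (f a (TopologicalSpace.denseSeq (Set.Icc (0:ℝ) T) n))
          (g (TopologicalSpace.denseSeq (Set.Icc (0:ℝ) T) n)) ≤ r} := by
      ext a
      simp only [mem_preimage, Metric.mem_closedBall, mem_iInter, mem_ofPred_eq]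
      rw [ContinuousMap.dist_le hr]
      constructor
      · intro hx n; exact hx _
      · intro hx s
        refine (TopologicalSpace.denseRange_denseSeq (Set.Icc (0:ℝ) T)).induction_on
          (p := fun s => dist (f a s) (g s) ≤ r) s ?_ hx
        exact isClosed_le ((f a).continuous.dist g.continuous) continuous_const
    rw [this]
    exact MeasurableSet.iInter fun n => measurableSet_le ((h _).dist measurable_const)
      measurable_const
  refine measurable_of_isOpen fun U hU => ?_
  have : f ⁻¹' U = ⋃ (n : ℕ) (k : ℕ) (_ : Metric.closedBall
      (TopologicalSpace.denseSeq (Path T) n) (1 / ((k:ℝ)+1)) ⊆ U),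
      f ⁻¹' Metric.closedBall (TopologicalSpace.denseSeq (Path T) n) (1 / ((k:ℝ)+1)) := by
    ext a
    simp only [mem_preimage, mem_iUnion, exists_prop]
    constructor
    · intro ha
      obtain ⟨ε, hε, hb⟩ := Metric.isOpen_iff.1 hU _ ha
      obtain ⟨k, hk⟩ := exists_nat_one_div_lt (half_pos hε)
      have hk0 : (0:ℝ) < 1 / ((k:ℝ)+1) := by positivity
      obtain ⟨n, hn⟩ := (TopologicalSpace.denseRange_denseSeq (Path T)).exists_dist_lt (f a) hk0
      refine ⟨n, k, ?_, ?_⟩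
      · intro y hy
        apply hb
        rw [Metric.mem_closedBall] at hy
        rw [Metric.mem_ball]
        have := dist_triangle y (TopologicalSpace.denseSeq (Path T) n) (f a)
        rw [dist_comm (TopologicalSpace.denseSeq (Path T) n) (f a)] at this
        linarith
      · rw [Metric.mem_closedBall]; exact hn.le
    · rintro ⟨n, k, h1, h2⟩
      exact h1 h2
  rw [this]
  exact MeasurableSet.iUnion fun n => MeasurableSet.iUnion fun k => MeasurableSet.iUnion fun _ =>
    hball _ _ (by positivity)

lemma Fraw_mono {s t : ℝ} (h : s ≤ t) : Fraw T s ≤ Fraw T t :=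
  iSup₂_le fun u hu => le_iSup₂_of_le u (hu.trans h) le_rfl

lemma Fraw_le (t : ℝ) : Fraw T t ≤ borel (Path T) := by
  refine iSup₂_le fun u _ => ?_
  refine Measurable.comap_le (m₁ := borel (Path T)) ?_
  have : Continuous fun ω : Path T => ω u := continuous_eval_const u
  exact this.measurable

lemma Fraw_eval {t : ℝ} (s : Set.Icc (0:ℝ) T) (h : (s:ℝ) ≤ t) :
    Measurable[Fraw T t] fun ω : Path T => ω s :=
  Measurable.of_comap_le (le_iSup₂_of_le s h le_rfl)

lemma stopPath_meas (t : Set.Icc (0:ℝ) T) :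
    Measurable[Fraw T t] fun ω : Path T => stopPath T ω t := by
  refine meas_path (m := Fraw T t) fun s => ?_
  exact Fraw_eval (t := (t:ℝ)) ⟨min t.1 s.1, le_min t.2.1 s.2.1, (min_le_left _ _).trans t.2.2⟩
    (min_le_left _ _)

lemma clamp_le_iff {x : ℝ} {a : Set.Icc (0:ℝ) T} (ha : (a:ℝ) < T) :
    clamp T hT x ≤ a ↔ x ≤ a := by
  rw [← Subtype.coe_le_coe]
  unfold clamp
  rw [coe_projIcc]
  have := a.2.1
  constructor
  · intro h
    have h1 := (le_max_right _ _).trans h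
    rcases min_le_iff.1 h1 with h2 | h2
    · linarith
    · exact h2
  · intro h
    exact max_le this ((min_le_right _ _).trans h)

lemma clamp_meas {ρ : Path T → ℝ} (hρ : IsStopRaw T ρ) (t : Set.Icc (0:ℝ) T) :
    Measurable[Fraw T t] fun ω => clamp T hT (min (ρ ω) t) := by
  refine @measurable_of_Iic _ _ _ _ _ (Fraw T t) _ _ _ _ fun a => ?_
  by_cases hta : t ≤ a
  · have : (fun ω => clamp T hT (min (ρ ω) t)) ⁻¹' Iic a = univ := by
      ext ω
      simp only [mem_preimage, mem_Iic, mem_univ, iff_true]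
      refine le_trans ?_ hta
      have : clamp T hT (t:ℝ) = t := projIcc_val hT t
      rw [← this]
      exact (monotone_projIcc hT) (by rw [this]; exact min_le_right _ _)
    rw [this]; exact @MeasurableSet.univ _ (Fraw T t)
  · have hat : (a:ℝ) < t := not_le.1 hta
    have : (fun ω => clamp T hT (min (ρ ω) t)) ⁻¹' Iic a = {ω | ρ ω ≤ a} := by
      ext ω
      simp only [mem_preimage, mem_Iic, mem_ofPred_eq]
      rw [clamp_le_iff hT (hat.trans_le t.2.2), min_le_iff]
      constructor
      · rintro (h | h)
        · exact h
        · linarith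
      · exact Or.inl
    rw [this]
    exact Fraw_mono hat.le _ (hρ a a.2)

lemma ev_stop_meas {ρ : Path T → ℝ} (hρ : IsStopRaw T ρ) (t : Set.Icc (0:ℝ) T) :
    Measurable[Fraw T t] fun ω => ev T hT ω (min (ρ ω) t) := by
  have h1 := (stopPath_meas t).prodMk (clamp_meas hT hρ t)
  have hc : Continuous fun p : Path T × Set.Icc (0:ℝ) T => p.1 p.2 := by fun_prop
  have h2 := hc.measurable.comp h1
  convert h2 using 1
  funext ω
  simp only [Function.comp]
  rw [← ev_of_mem hT, ev_stopPath]
  rw [← ev_clamp hT ω (min (ρ ω) t)]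
  congr 1
  refine (min_eq_right ?_).symm
  unfold clamp
  rw [coe_projIcc]
  exact max_le t.2.1 ((min_le_right _ _).trans (min_le_right _ _))

lemma stopτ_eval (ω : Path T) (r : ℝ) (s : Set.Icc (0:ℝ) T) :
    stopPath T ω (clamp T hT r) s = ev T hT ω (min r s) := by
  rw [← ev_of_mem hT, ev_stopPath]
  unfold ev
  congr 1
  unfold clamp
  apply Subtype.ext
  simp only [coe_projIcc]
  have h1 := s.2.1
  have h2 := s.2.2
  rcases le_total 0 (min r s) with h | h
  · rcases le_total r T with h' | h'
    · have := h.trans (min_le_left _ _)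
      rw [min_eq_right h', max_eq_right this]
    · rw [min_eq_left h', max_eq_right hT, min_eq_right h2, min_eq_right (h2.trans h')]
  · rcases min_le_iff.1 h with h' | h'
    · rw [min_eq_right (h'.trans hT), max_eq_left h', min_eq_left h1, min_eq_left (h'.trans h1),
        min_eq_right hT, min_eq_right (h'.trans hT), max_eq_left h', max_self]
    · have hs : (s:ℝ) = 0 := le_antisymm h' h1
      rw [hs, min_eq_right (le_max_left _ _), min_eq_right hT, max_self,
        max_eq_left ((min_le_right _ _).trans (min_le_right _ _))]

lemma stopτ_measF {τ : Path T → ℝ} (hτ : IsStopRaw T τ) {s : ℝ} :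
    Measurable[Fraw T s, Fraw T s] fun ω => stopPath T ω (clamp T hT (τ ω)) := by
  rw [measurable_iff_le_map]
  refine iSup₂_le fun u hu => ?_
  rw [MeasurableSpace.comap_le_iff_le_map, MeasurableSpace.map_comp,
    ← measurable_iff_le_map]
  have : ((fun ω : Path T => ω u) ∘ fun ω => stopPath T ω (clamp T hT (τ ω))) =
      fun ω => ev T hT ω (min (τ ω) u) := by
    funext ω; exact stopτ_eval hT ω _ u
  rw [this]
  exact (ev_stop_meas hT hτ u).mono (Fraw_mono hu) le_rfl

lemma stopτ_meas {τ : Path T → ℝ} (hτ : IsStopRaw T τ) :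
    Measurable fun ω => stopPath T ω (clamp T hT (τ ω)) := by
  refine meas_path fun s => ?_
  simp_rw [stopτ_eval hT]
  exact (ev_stop_meas hT hτ s).mono (Fraw_le _) le_rfl

/-- hitting times -/
def hit (m : ℕ) (ω : Path T) : ℝ :=
  sInf ({t : ℝ | 0 ≤ t ∧ t ≤ T ∧ (m:ℝ) ≤ |ev T hT ω t - ev T hT ω 0|} ∪ {T + m + 1})

lemma hit_bdd (m : ℕ) (ω : Path T) :
    BddBelow ({t : ℝ | 0 ≤ t ∧ t ≤ T ∧ (m:ℝ) ≤ |ev T hT ω t - ev T hT ω 0|} ∪ {T + m + 1}) := by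
  refine ⟨0, ?_⟩
  rintro x (hx | hx)
  · exact hx.1
  · rw [mem_singleton_iff.1 hx]; positivity

lemma hit_mem (m : ℕ) (ω : Path T) :
    hit hT m ω ∈ ({t : ℝ | 0 ≤ t ∧ t ≤ T ∧ (m:ℝ) ≤ |ev T hT ω t - ev T hT ω 0|}
      ∪ {T + m + 1}) := by
  have hc : IsClosed ({t : ℝ | 0 ≤ t ∧ t ≤ T ∧ (m:ℝ) ≤ |ev T hT ω t - ev T hT ω 0|}
      ∪ {T + m + 1}) := by
    refine IsClosed.union ?_ isClosed_singleton
    have h3 : IsClosed {t : ℝ | (m:ℝ) ≤ |ev T hT ω t - ev T hT ω 0|} :=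
      isClosed_le continuous_const ((ev_cont hT ω).sub continuous_const).abs
    exact (isClosed_le continuous_const continuous_id).inter
      ((isClosed_le continuous_id continuous_const).inter h3)
  exact hc.csInf_mem ⟨_, Or.inr rfl⟩ (hit_bdd hT m ω)

lemma hit_nonneg (m : ℕ) (ω : Path T) : 0 ≤ hit hT m ω := by
  rcases hit_mem hT m ω with h | h
  · exact h.1
  · rw [mem_singleton_iff.1 h]; positivity

lemma hit_le_iff (m : ℕ) (ω : Path T) {t : ℝ} (ht : t ≤ T) : hit hT m ω ≤ t ↔
    ∃ u : ℝ, 0 ≤ u ∧ u ≤ t ∧ (m:ℝ) ≤ |ev T hT ω u - ev T hT ω 0| := by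
  constructor
  · intro h
    rcases hit_mem hT m ω with h' | h'
    · exact ⟨_, h'.1, h, h'.2.2⟩
    · rw [mem_singleton_iff.1 h'] at h
      have : (0:ℝ) ≤ m := by positivity
      linarith
  · rintro ⟨u, h1, h2, h3⟩
    exact (csInf_le (hit_bdd hT m ω) (Or.inl ⟨h1, h2.trans ht, h3⟩)).trans h2

lemma hit_mono (ω : Path T) : Monotone fun m => hit hT m ω := by
  refine monotone_nat_of_le_succ fun m => ?_
  rcases hit_mem hT (m+1) ω with h | h
  · refine csInf_le (hit_bdd hT m ω) (Or.inl ⟨h.1, h.2.1, le_trans ?_ h.2.2⟩)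
    push_cast; linarith
  · rw [mem_singleton_iff.1 h]
    refine (csInf_le (hit_bdd hT m ω) (Or.inr rfl)).trans ?_
    push_cast; linarith

lemma hit_tendsto (ω : Path T) : Tendsto (fun m => hit hT m ω) atTop atTop := by
  obtain ⟨N, hN⟩ := exists_nat_gt (2 * ‖ω‖)
  have h1 : ∀ m ≥ N, (m:ℝ) ≤ hit hT m ω := by
    intro m hm
    rcases hit_mem hT m ω with h | h
    · exfalso
      have h2 := h.2.2
      have h3 : |ev T hT ω (hit hT m ω) - ev T hT ω 0| ≤ 2 * ‖ω‖ := by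
        have a1 := ω.norm_coe_le_norm (clamp T hT (hit hT m ω))
        have a2 := ω.norm_coe_le_norm (clamp T hT 0)
        have a3 := abs_sub (ev T hT ω (hit hT m ω)) (ev T hT ω 0)
        rw [Real.norm_eq_abs] at a1 a2
        unfold ev at *
        linarith
      have : (N:ℝ) ≤ m := by exact_mod_cast hm
      linarith
    · rw [mem_singleton_iff.1 h]; linarith
  refine tendsto_atTop_mono' _ ?_ tendsto_natCast_atTop_atTop
  filter_upwards [eventually_ge_atTop N] with m hm using h1 m hm

lemma hit_bound (m : ℕ) (ω : Path T) {u : ℝ} (hu : u ≤ hit hT m ω) :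
    |ev T hT ω u - ev T hT ω 0| ≤ m := by
  by_contra hcon
  have hcon := not_le.1 hcon
  have hm0 : (0:ℝ) ≤ m := by positivity
  have hu0 : 0 ≤ u := by
    by_contra h
    rw [ev_le_zero hT ω (not_le.1 h).le] at hcon
    simp at hcon; linarith
  -- replace u by min u T
  have hv : ev T hT ω (min u T) = ev T hT ω u := by
    unfold ev clamp
    congr 1
    apply Subtype.ext
    simp only [coe_projIcc]
    rw [min_comm u T, ← min_assoc, min_self]
  rw [← hv] at hcon
  set v := min u T
  have hv0 : 0 ≤ v := le_min hu0 hT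
  have hcont : ContinuousOn (fun x => |ev T hT ω x - ev T hT ω 0|) (Icc 0 v) :=
    ((ev_cont hT ω).sub continuous_const).abs.continuousOn
  obtain ⟨x, hx, hxe⟩ := intermediate_value_Icc hv0 hcont (show (m:ℝ) ∈ _ by
    refine ⟨by simp, hcon.le⟩)
  have hxv : x ≠ v := by
    rintro rfl
    simp only at hxe
    linarith
  have hlt := lt_of_le_of_ne hx.2 hxv
  have := (hit_le_iff hT m ω (hx.2.trans (min_le_right _ _))).2 ⟨x, hx.1, le_rfl, hxe.ge⟩
  have : v ≤ hit hT m ω := (min_le_left _ _).trans hu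
  linarith

lemma hit_stop (m : ℕ) : IsStopRaw T (hit hT m) := by
  intro t ht
  have hne : Nonempty (Set.Icc (0:ℝ) T) := ⟨⟨t, ht⟩⟩
  have hc : Continuous fun ω : Path T => ‖ω - ContinuousMap.const _ (ω (t0 T hT))‖ := by
    refine (continuous_id.sub ?_).norm
    exact ContinuousMap.continuous_const'.comp (continuous_eval_const _)
  have h1 := hc.measurable.comp (stopPath_meas ⟨t, ht⟩)
  have h2 := h1 (measurableSet_Ici (a := (m:ℝ)))
  convert h2 using 1
  ext ω
  simp only [mem_ofPred_eq, mem_preimage, mem_Ici, Function.comp]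
  rw [hit_le_iff hT m ω ht.2, ← not_iff_not, not_le, ContinuousMap.norm_lt_iff_of_nonempty]
  have e0 : stopPath T ω ⟨t, ht⟩ (t0 T hT) = ev T hT ω 0 := by
    rw [← ev_of_mem hT, ev_stopPath]; simp [t0, ht.1]
  have e1 : ∀ x : Set.Icc (0:ℝ) T, stopPath T ω ⟨t, ht⟩ x = ev T hT ω (min t x) := by
    intro x
    rw [← ev_of_mem hT, ev_stopPath]
  simp only [ContinuousMap.sub_apply, ContinuousMap.const_apply, e0, e1, Real.norm_eq_abs]
  push Not
  constructor
  · intro h x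
    exact h _ (le_min ht.1 x.2.1) (min_le_left _ _)
  · intro h u hu0 hut
    have := h ⟨u, hu0, hut.trans ht.2⟩
    rwa [min_eq_right hut] at this

lemma hit_stopPath (m : ℕ) (ω : Path T) (r : Set.Icc (0:ℝ) T) :
    min (r:ℝ) (hit hT m (stopPath T ω r)) = min (r:ℝ) (hit hT m ω) := by
  have key : ∀ t : ℝ, t ≤ r → (hit hT m (stopPath T ω r) ≤ t ↔ hit hT m ω ≤ t) := by
    intro t ht
    rw [hit_le_iff hT _ _ (ht.trans r.2.2), hit_le_iff hT _ _ (ht.trans r.2.2)]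
    refine exists_congr fun u => and_congr_right fun h0 => and_congr_right fun h1 => ?_
    rw [ev_stopPath, ev_stopPath, min_eq_right (h1.trans ht), min_eq_right r.2.1]
  by_cases h : hit hT m ω ≤ r
  · have h2 := (key _ le_rfl).2 h
    have : hit hT m (stopPath T ω r) = hit hT m ω :=
      le_antisymm ((key _ h).2 le_rfl) ((key _ h2).1 le_rfl)
    rw [this]
  · have h2 : ¬ hit hT m (stopPath T ω r) ≤ r := fun h' => h ((key _ le_rfl).1 h')
    rw [min_eq_left (not_le.1 h).le, min_eq_left (not_le.1 h2).le]

end PartTwo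

end PathwiseSuperhedging

namespace PathwiseSuperhedging

section PartThree
variable {T : ℝ} (hT : 0 ≤ T)

/-- the raw filtration indexed by `[0,T]` -/
def filt (T : ℝ) : Filtration (Set.Icc (0:ℝ) T) (inferInstance : MeasurableSpace (Path T)) where
  seq t := Fraw T t
  mono' _ _ h := Fraw_mono h
  le' _ := Fraw_le _

lemma isMart_martingale {Q : Measure (Path T)} [IsProbabilityMeasure Q] {τ : Path T → ℝ}
    (hτ : IsStopRaw T τ) (hM : IsMart T Q (fun t ω => ev T hT ω (min (τ ω) t))) :
    Martingale (fun (t : Set.Icc (0:ℝ) T) ω => ev T hT ω (min (τ ω) t)) (filt T) Q := by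
  have had : ∀ i : Set.Icc (0:ℝ) T, StronglyMeasurable[filt T i]
      (fun ω => ev T hT ω (min (τ ω) i)) :=
    fun i => (ev_stop_meas hT hτ i).stronglyMeasurable
  refine ⟨had, fun i j hij => ?_⟩
  symm
  refine ae_eq_condExp_of_forall_setIntegral_eq ((filt T).le i) (hM.1 j j.2)
    (fun s _ _ => (hM.1 i i.2).integrableOn) (fun s hs _ => ?_) (had i).aestronglyMeasurable
  exact (hM.2 i j i.2 j.2 hij s hs).symm

/-- grid rounding from above -/
def rnd (k : ℕ) (x : ℝ) : ℝ := (⌈x * ((k:ℝ)+1)⌉₊ : ℝ) / ((k:ℝ)+1)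

lemma rnd_le_iff (k : ℕ) {x y : ℝ} : rnd k x ≤ y ↔ 0 ≤ y ∧ x ≤ (⌊y * ((k:ℝ)+1)⌋₊ : ℝ) / ((k:ℝ)+1) := by
  have hk : (0:ℝ) < (k:ℝ)+1 := by positivity
  unfold rnd
  rw [div_le_iff₀ hk, le_div_iff₀ hk]
  constructor
  · intro h
    have h0 : 0 ≤ y * ((k:ℝ)+1) := le_trans (by positivity) h
    refine ⟨nonneg_of_mul_nonneg_left h0 hk, ?_⟩
    rw [← Nat.ceil_le]
    exact Nat.le_floor h
  · rintro ⟨h0, h⟩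
    rw [← Nat.ceil_le] at h
    exact le_trans (by exact_mod_cast h) (Nat.floor_le (by positivity))

lemma le_rnd (k : ℕ) (x : ℝ) : x ≤ rnd k x := by
  have hk : (0:ℝ) < (k:ℝ)+1 := by positivity
  unfold rnd
  rw [le_div_iff₀ hk]
  exact Nat.le_ceil _

lemma rnd_le (k : ℕ) {x : ℝ} (hx : 0 ≤ x) : rnd k x ≤ x + 1 / ((k:ℝ)+1) := by
  have hk : (0:ℝ) < (k:ℝ)+1 := by positivity
  unfold rnd
  rw [div_le_iff₀ hk, add_mul, one_div, inv_mul_cancel₀ hk.ne']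
  exact (Nat.ceil_lt_add_one (by positivity)).le

lemma rnd_tendsto {x : ℝ} (hx : 0 ≤ x) : Tendsto (fun k => rnd k x) atTop (𝓝 x) := by
  refine tendsto_of_tendsto_of_tendsto_of_le_of_le tendsto_const_nhds ?_ (fun k => le_rnd k x)
    (fun k => rnd_le k hx)
  simpa using tendsto_const_nhds.add (tendsto_one_div_add_atTop_nhds_zero_nat (𝕜 := ℝ))

lemma rnd_stop {ρ : Path T → ℝ} (hρ : IsStopRaw T ρ) (k : ℕ) :
    IsStoppingTime (filt T) fun ω => ((clamp T hT (rnd k (ρ ω)) : Set.Icc (0:ℝ) T) :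
      WithTop (Set.Icc (0:ℝ) T)) := by
  intro i
  have hk : (0:ℝ) < (k:ℝ)+1 := by positivity
  simp only [WithTop.coe_le_coe]
  by_cases hi : (i:ℝ) < T
  · simp_rw [clamp_le_iff hT hi, rnd_le_iff]
    have hle : (⌊(i:ℝ) * ((k:ℝ)+1)⌋₊ : ℝ) / ((k:ℝ)+1) ≤ i := by
      rw [div_le_iff₀ hk]; exact Nat.floor_le (mul_nonneg i.2.1 hk.le)
    have := Fraw_mono hle _ (hρ _ ⟨by positivity, hle.trans i.2.2⟩)
    have e : {ω : Path T | 0 ≤ (i:ℝ) ∧ ρ ω ≤ (⌊(i:ℝ) * ((k:ℝ)+1)⌋₊ : ℝ) / ((k:ℝ)+1)} =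
        {ω | ρ ω ≤ (⌊(i:ℝ) * ((k:ℝ)+1)⌋₊ : ℝ) / ((k:ℝ)+1)} := by
      ext ω; exact and_iff_right i.2.1
    rw [e]
    exact this
  · have : {ω : Path T | clamp T hT (rnd k (ρ ω)) ≤ i} = univ := by
      ext ω
      simp only [mem_ofPred_eq, mem_univ, iff_true]
      rw [← Subtype.coe_le_coe]
      exact (clamp T hT _).2.2.trans (not_lt.1 hi)
    rw [this]
    exact @MeasurableSet.univ _ (Fraw T i)

lemma ost {Q : Measure (Path T)} [IsProbabilityMeasure Q] {τ : Path T → ℝ}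
    (hτ : IsStopRaw T τ) (hM : IsMart T Q (fun t ω => ev T hT ω (min (τ ω) t)))
    {ρ : Path T → ℝ} (hρ : IsStopRaw T ρ) (hmem : ∀ ω, ρ ω ∈ Set.Icc (0:ℝ) T)
    (hint : Integrable (fun ω => ev T hT ω (min (τ ω) (ρ ω))) Q) :
    ∫ ω, ev T hT ω (min (τ ω) (ρ ω)) ∂Q = ∫ ω, ev T hT ω (min (τ ω) T) ∂Q := by
  have hmart := isMart_martingale hT hτ hM
  set M : Set.Icc (0:ℝ) T → Path T → ℝ := fun t ω => ev T hT ω (min (τ ω) t) with hMdef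
  let top : Set.Icc (0:ℝ) T := ⟨T, hT, le_rfl⟩
  have : Nonempty (Set.Icc (0:ℝ) T) := ⟨top⟩
  let ρk : ℕ → Path T → WithTop (Set.Icc (0:ℝ) T) := fun k ω =>
    ((clamp T hT (rnd k (ρ ω)) : Set.Icc (0:ℝ) T) : WithTop (Set.Icc (0:ℝ) T))
  have hst : ∀ k, IsStoppingTime (filt T) (ρk k) := fun k => rnd_stop hT hρ k
  have hle : ∀ k ω, ρk k ω ≤ top := fun k ω => WithTop.coe_le_coe.2 (clamp T hT _).2.2
  have hms : ∀ k, (hst k).measurableSpace ≤ (inferInstance : MeasurableSpace (Path T)) :=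
    fun k => (hst k).measurableSpace_le_of_le (hle k)
  have hcount : ∀ k, (Set.range (ρk k)).Countable := by
    intro k
    refine (Set.countable_range (fun n : ℕ => ((clamp T hT ((n:ℝ) / ((k:ℝ)+1)) :
      Set.Icc (0:ℝ) T) : WithTop (Set.Icc (0:ℝ) T)))).mono ?_
    rintro _ ⟨ω, rfl⟩
    exact ⟨⌈ρ ω * ((k:ℝ)+1)⌉₊, rfl⟩
  have hce : ∀ k, (fun ω => M (clamp T hT (rnd k (ρ ω))) ω) =ᵐ[Q]
      Q[M top | (hst k).measurableSpace] := fun k =>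
    hmart.stoppedValue_ae_eq_condExp_of_le_const_of_countable_range (hst k) (hle k) (hcount k)
  have hui : UniformIntegrable (fun k => Q[M top | (hst k).measurableSpace]) 1 Q :=
    (hM.1 T ⟨hT, le_rfl⟩).uniformIntegrable_condExp hms
  have hlim : ∀ ω, Tendsto (fun k => M (clamp T hT (rnd k (ρ ω))) ω) atTop
      (𝓝 (ev T hT ω (min (τ ω) (ρ ω)))) := by
    intro ω
    have h1 : Continuous fun x : ℝ => ev T hT ω (min (τ ω) (clamp T hT x : ℝ)) := by
      refine (ev_cont hT ω).comp (continuous_const.min ?_)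
      exact continuous_subtype_val.comp (continuous_projIcc (h := hT))
    have h2 := (h1.tendsto (ρ ω)).comp (rnd_tendsto (hmem ω).1)
    have h3 : (clamp T hT (ρ ω) : ℝ) = ρ ω := by
      unfold clamp; rw [projIcc_of_mem hT (hmem ω)]
    rw [h3] at h2
    exact h2
  have hae : ∀ᵐ ω ∂Q, Tendsto (fun k => (Q[M top | (hst k).measurableSpace]) ω) atTop
      (𝓝 (ev T hT ω (min (τ ω) (ρ ω)))) := by
    filter_upwards [ae_all_iff.2 hce] with ω hω
    have := hlim ω
    simp_rw [hω] at this
    exact this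
  have hL1 := tendsto_Lp_finite_of_tendsto_ae le_rfl ENNReal.one_ne_top
    (fun k => hui.1 k) (memLp_one_iff_integrable.2 hint) hui.2.1 hae
  have hconv := tendsto_integral_of_L1' _ hint.1
    (Eventually.of_forall fun k => integrable_condExp) hL1
  have hconst : ∀ k, ∫ ω, (Q[M top | (hst k).measurableSpace]) ω ∂Q = ∫ ω, M top ω ∂Q :=
    fun k => integral_condExp (hms k)
  simp_rw [hconst] at hconv
  exact (tendsto_nhds_unique hconv tendsto_const_nhds)

/-- the stopping time equal to `ρ ∧ t` on `A`, `ρ ∧ s` off `A`. -/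
lemma piece_stop {ρ : Path T → ℝ} (hρ : IsStopRaw T ρ) {s t : ℝ} (hst : s ≤ t)
    {A : Set (Path T)} (hA : MeasurableSet[Fraw T s] A) :
    IsStopRaw T fun ω => if ω ∈ A then min (ρ ω) t else min (ρ ω) s := by
  intro u hu
  have hu' := hρ u hu
  by_cases h : s ≤ u
  · have hA' := Fraw_mono h _ hA
    have : {ω | (if ω ∈ A then min (ρ ω) t else min (ρ ω) s) ≤ u} =
        (A ∩ ({ω | ρ ω ≤ u} ∪ {ω | t ≤ u})) ∪ Aᶜ := by
      ext ω
      by_cases hω : ω ∈ A <;> simp [hω, h]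
    rw [this]
    refine MeasurableSet.union (m := Fraw T u) (MeasurableSet.inter (m := Fraw T u) hA' ?_)
      (MeasurableSet.compl (m := Fraw T u) hA')
    exact MeasurableSet.union (m := Fraw T u) hu' (MeasurableSet.const (m := Fraw T u) _)
  · have : {ω | (if ω ∈ A then min (ρ ω) t else min (ρ ω) s) ≤ u} = {ω | ρ ω ≤ u} := by
      ext ω
      have h2 : ¬ t ≤ u := fun h' => h (le_trans hst h')
      by_cases hω : ω ∈ A <;> simp [hω, h, h2]
    rw [this]; exact hu'

lemma min_stop {ρ ρ' : Path T → ℝ} (hρ : IsStopRaw T ρ) (hρ' : IsStopRaw T ρ') :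
    IsStopRaw T fun ω => min (ρ ω) (ρ' ω) := by
  intro u hu
  have : {ω | min (ρ ω) (ρ' ω) ≤ u} = {ω | ρ ω ≤ u} ∪ {ω | ρ' ω ≤ u} := by
    ext ω; simp
  rw [this]
  exact MeasurableSet.union (m := Fraw T u) (hρ u hu) (hρ' u hu)

lemma ev_stop_aesm {Q : Measure (Path T)} {ρ : Path T → ℝ} (hρ : IsStopRaw T ρ) :
    AEStronglyMeasurable (fun ω => ev T hT ω (ρ ω)) Q := by
  have h := ((ev_stop_meas hT hρ ⟨T, hT, le_rfl⟩).mono (Fraw_le _) le_rfl)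
  have e : (fun ω => ev T hT ω (min (ρ ω) T)) = fun ω => ev T hT ω (ρ ω) := by
    funext ω
    unfold ev clamp
    congr 1
    apply Subtype.ext
    simp only [coe_projIcc]
    rw [min_comm (ρ ω) T, ← min_assoc, min_self]
  simp only [e] at h
  exact h.aestronglyMeasurable

lemma const_stop (c : ℝ) : IsStopRaw T fun _ => c := fun u _ =>
  MeasurableSet.const (m := Fraw T u) _

lemma bound_int {Q : Measure (Path T)} [IsProbabilityMeasure Q]
    (h0 : Integrable (fun ω => ev T hT ω 0) Q) (m : ℕ)
    {ρ : Path T → ℝ} (hρ : IsStopRaw T ρ) (hle : ∀ ω, ρ ω ≤ hit hT m ω) :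
    Integrable (fun ω => ev T hT ω (ρ ω)) Q := by
  refine (h0.norm.add (integrable_const (m:ℝ))).mono' (ev_stop_aesm hT hρ)
    (Eventually.of_forall fun ω => ?_)
  have := hit_bound hT m ω (hle ω)
  simp only [Real.norm_eq_abs, Pi.add_apply]
  have h2 := abs_sub_abs_le_abs_sub (ev T hT ω (ρ ω)) (ev T hT ω 0)
  linarith

lemma min_nonneg_ev (ω : Path T) (x : ℝ) : ev T hT ω (min x 0) = ev T hT ω 0 :=
  ev_le_zero hT ω (min_le_right _ _)

lemma stopped_mart {Q : Measure (Path T)} [IsProbabilityMeasure Q]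
    (hQ : IsLocalMart T Q (Sproc T hT)) (m : ℕ) {τ : Path T → ℝ} (hτ : IsStopRaw T τ)
    (hmem : ∀ ω, τ ω ∈ Set.Icc (0:ℝ) T) :
    IsMart T Q fun t ω => ev T hT ω (min (min (τ ω) (hit hT m ω)) t) := by
  obtain ⟨θ, hθ, hθlim, hθM⟩ := hQ
  have h0 : Integrable (fun ω => ev T hT ω 0) Q := by
    have := (hθM 0).1 0 ⟨le_rfl, hT⟩
    simp only [Sproc, min_nonneg_ev] at this
    exact this
  set ρ : Path T → ℝ := fun ω => min (τ ω) (hit hT m ω) with hρdef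
  have hρ : IsStopRaw T ρ := min_stop hτ (hit_stop hT m)
  have hρm : ∀ ω, ρ ω ∈ Set.Icc (0:ℝ) T := fun ω =>
    ⟨le_min (hmem ω).1 (hit_nonneg hT m ω), (min_le_left _ _).trans (hmem ω).2⟩
  have hρh : ∀ ω, ρ ω ≤ hit hT m ω := fun ω => min_le_right _ _
  have key : ∀ ρ' : Path T → ℝ, IsStopRaw T ρ' → (∀ ω, ρ' ω ∈ Set.Icc (0:ℝ) T) →
      (∀ ω, ρ' ω ≤ hit hT m ω) → ∫ ω, ev T hT ω (ρ' ω) ∂Q = ∫ ω, ev T hT ω 0 ∂Q := by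
    intro ρ' h1 h2 h3
    have hn : ∀ n, ∫ ω, ev T hT ω (min (θ n ω) (ρ' ω)) ∂Q = ∫ ω, ev T hT ω 0 ∂Q := by
      intro n
      rw [ost hT (hθ n) (hθM n) h1 h2 (bound_int hT h0 m (min_stop (hθ n) h1)
        fun ω => (min_le_right _ _).trans (h3 ω))]
      have := (hθM n).2 0 T ⟨le_rfl, hT⟩ ⟨hT, le_rfl⟩ hT univ (@MeasurableSet.univ _ (Fraw T 0))
      simp only [Measure.restrict_univ, Sproc, min_nonneg_ev] at this
      exact this
    have hlim : Tendsto (fun n => ∫ ω, ev T hT ω (min (θ n ω) (ρ' ω)) ∂Q) atTop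
        (𝓝 (∫ ω, ev T hT ω (ρ' ω) ∂Q)) := by
      refine tendsto_integral_of_dominated_convergence (fun ω => |ev T hT ω 0| + m)
        (fun n => ev_stop_aesm hT (min_stop (hθ n) h1)) (h0.abs.add (integrable_const _))
        (fun n => Eventually.of_forall fun ω => ?_) ?_
      · have := hit_bound hT m ω (u := min (θ n ω) (ρ' ω)) ((min_le_right _ _).trans (h3 ω))
        have h2 := abs_sub_abs_le_abs_sub (ev T hT ω (min (θ n ω) (ρ' ω))) (ev T hT ω 0)
        rw [Real.norm_eq_abs]
        linarith
      · filter_upwards [hθlim] with ω hω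
        refine tendsto_const_nhds.congr' ?_
        filter_upwards [hω.2.eventually_ge_atTop (ρ' ω)] with n hn
        rw [min_eq_right hn]
    simp_rw [hn] at hlim
    exact tendsto_nhds_unique tendsto_const_nhds hlim |>.symm
  refine ⟨fun t ht => bound_int hT h0 m (min_stop hρ (const_stop t))
    fun ω => (min_le_left _ _).trans (hρh ω), ?_⟩
  intro s t hs ht hst A hA
  have hAm : MeasurableSet A := Fraw_le s _ hA
  have iT := bound_int (Q := Q) hT h0 m (min_stop hρ (const_stop t))
    fun ω => (min_le_left _ _).trans (hρh ω)
  have iS := bound_int (Q := Q) hT h0 m (min_stop hρ (const_stop s))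
    fun ω => (min_le_left _ _).trans (hρh ω)
  have e1 := key _ (piece_stop hρ hst hA) (by
    intro ω
    beta_reduce
    split_ifs
    · exact ⟨le_min (hρm ω).1 ht.1, (min_le_left _ _).trans (hρm ω).2⟩
    · exact ⟨le_min (hρm ω).1 hs.1, (min_le_left _ _).trans (hρm ω).2⟩) (by
    intro ω
    beta_reduce
    split_ifs <;> exact (min_le_left _ _).trans (hρh ω))
  have e2 := key _ (min_stop hρ (const_stop s)) (fun ω =>
    ⟨le_min (hρm ω).1 hs.1, (min_le_left _ _).trans (hρm ω).2⟩)
    fun ω => (min_le_left _ _).trans (hρh ω)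
  have i1 : Integrable (fun ω => ev T hT ω (if ω ∈ A then min (ρ ω) t else min (ρ ω) s)) Q :=
    bound_int hT h0 m (piece_stop hρ hst hA) (by
      intro ω
      beta_reduce
      split_ifs <;> exact (min_le_left _ _).trans (hρh ω))
  rw [← e2, ← integral_add_compl hAm i1, ← integral_add_compl hAm iS] at e1
  have c1 : ∫ ω in A, ev T hT ω (if ω ∈ A then min (ρ ω) t else min (ρ ω) s) ∂Q =
      ∫ ω in A, ev T hT ω (min (ρ ω) t) ∂Q :=
    setIntegral_congr_fun hAm fun ω hω => by simp only [if_pos hω]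
  have c2 : ∫ ω in Aᶜ, ev T hT ω (if ω ∈ A then min (ρ ω) t else min (ρ ω) s) ∂Q =
      ∫ ω in Aᶜ, ev T hT ω (min (ρ ω) s) ∂Q :=
    setIntegral_congr_fun hAm.compl fun ω hω => by
      have : ω ∉ A := hω
      simp only [if_neg this]
  rw [c1, c2] at e1
  exact add_right_cancel e1

lemma map_isLocalMart {Q : Measure (Path T)} [IsProbabilityMeasure Q]
    (hQ : IsLocalMart T Q (Sproc T hT)) {τ : Path T → ℝ} (hτ : IsStopRaw T τ)
    (hmem : ∀ ω, τ ω ∈ Set.Icc (0:ℝ) T) :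
    IsLocalMart T (Q.map fun ω => stopPath T ω (clamp T hT (τ ω))) (Sproc T hT) := by
  have hf := stopτ_meas hT hτ
  refine ⟨hit hT, hit_stop hT, Eventually.of_forall fun ω => ⟨hit_mono hT ω, hit_tendsto hT ω⟩,
    fun m => ?_⟩
  have hM := stopped_mart hT hQ m hτ hmem
  have e : ∀ t ω, ev T hT (stopPath T ω (clamp T hT (τ ω)))
      (min (hit hT m (stopPath T ω (clamp T hT (τ ω)))) t) =
      ev T hT ω (min (min (τ ω) (hit hT m ω)) t) := by
    intro t ω
    have h3 : (clamp T hT (τ ω) : ℝ) = τ ω := by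
      unfold clamp; rw [projIcc_of_mem hT (hmem ω)]
    rw [ev_stopPath, ← min_assoc, hit_stopPath, h3]
  have hsm : ∀ t, AEStronglyMeasurable (fun ω => ev T hT ω (min (hit hT m ω) t))
      (Q.map fun ω => stopPath T ω (clamp T hT (τ ω))) :=
    fun t => ev_stop_aesm hT (min_stop (hit_stop hT m) (const_stop t))
  refine ⟨fun t ht => ?_, fun s t hs ht hst A hA => ?_⟩
  · have := hM.1 t ht
    unfold Sproc
    rw [integrable_map_measure (hsm t) hf.aemeasurable]
    refine this.congr (Eventually.of_forall fun ω => ?_)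
    exact (e t ω).symm
  · have hAm : MeasurableSet A := Fraw_le s _ hA
    have hA' := stopτ_measF hT hτ hA
    have := hM.2 s t hs ht hst _ hA'
    unfold Sproc
    rw [setIntegral_map hAm (hsm t) hf.aemeasurable, setIntegral_map hAm (hsm s) hf.aemeasurable]
    simp_rw [e]
    exact this

lemma erealPos_meas : Measurable erealPos := by
  unfold erealPos
  exact Measurable.ite (measurableSet_singleton _) measurable_const
    (ENNReal.measurable_ofReal.comp measurable_ereal_toReal)

lemma expEReal_map {Q : Measure (Path T)} {f : Path T → Path T} (hf : Measurable f)
    {ξ : Path T → EReal} (hξ : Measurable ξ) :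
    expEReal (Q.map f) ξ = expEReal Q fun ω => ξ (f ω) := by
  have h1 := lintegral_map (μ := Q) (erealPos_meas.comp hξ) hf
  have h2 := lintegral_map (μ := Q) (erealPos_meas.comp (measurable_neg.comp hξ)) hf
  simp only [Function.comp] at h1 h2
  unfold expEReal
  rw [h1, h2]

lemma stop_top (ω : Path T) : stopPath T ω (clamp T hT T) = ω := by
  ext s
  rw [stopτ_eval, min_eq_right s.2.2, ev_of_mem]

end PartThree

end PathwiseSuperhedging

namespace PathwiseSuperhedging

/-- **Remark 2.8 (American-type identity).** Under Assumption A, for every Borel claim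
`ξ` bounded from below, the supremum of `E_Q[ξ]` over `Q ∈ M(Ξ)` equals the supremum over
all `𝔽`-stopping times `τ` and `Q ∈ M(Ξ)` of `E_Q[ξ(S^τ)]`. -/
theorem sup_eq_sup_over_stopped (T : ℝ) (hT : 0 ≤ T)
    (Ξ : Set (Path T)) (Xibar : Set (PathPair T)) (hA : AssumptionA T hT Ξ Xibar)
    (ξ : Path T → EReal) (hmeas : Measurable ξ)
    (hbelow : ∃ b : ℝ, ∀ ω, (b : EReal) ≤ ξ ω) :
    (⨆ Q ∈ MSet T hT Ξ, expEReal Q ξ) =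
      ⨆ τ : {τ : Path T → ℝ // IsStopRaw T τ ∧ ∀ ω, τ ω ∈ Set.Icc (0:ℝ) T},
        ⨆ Q ∈ MSet T hT Ξ, expEReal Q (fun ω => ξ (stopPath T ω (clamp T hT (τ.1 ω)))) := by
  apply le_antisymm
  · refine le_iSup_of_le ⟨fun _ => T, const_stop T, fun _ => ⟨hT, le_rfl⟩⟩ ?_
    simp only [stop_top]
    exact le_rfl
  · refine iSup_le fun τ => iSup₂_le fun Q hQ => ?_
    obtain ⟨τ, hτ, hmem⟩ := τ
    obtain ⟨hP, hL, hΞ⟩ := hQ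
    have hf := stopτ_meas hT hτ
    have hP' : IsProbabilityMeasure (Q.map fun ω => stopPath T ω (clamp T hT (τ ω))) :=
      Measure.isProbabilityMeasure_map hf.aemeasurable
    refine le_iSup₂_of_le (Q.map fun ω => stopPath T ω (clamp T hT (τ ω)))
      ⟨hP', map_isLocalMart hT hL hτ hmem, ?_⟩ ?_
    · refine le_antisymm prob_le_one ?_
      refine le_trans ?_ (Measure.le_map_apply hf.aemeasurable Ξ)
      rw [← hΞ]
      exact measure_mono fun ω hω => stop_mem_Xi hT hA hω _
    · rw [expEReal_map hf hmeas]

end PathwiseSuperhedging
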